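/- For every positive integer m, the rational number ∑_{s=0}^{m} ∑_{k=s}^{m} ((1+2k)/(1+2s)) · C(2m+1, m-k) · C(k+s, 2s) / L_{2k+1} equals 4^m. (This is the statement W_{2m+1}(1) = 0, i.e., that x - 1 divides the polynomial W_{2m+1}(x) = ∑_{s=0}^{m} x^{2s+1} ∑_{k=s}^{m} ((1+2k)/(1+2s)) C(2m+1, m-k) C(k+s, 2s) / L_{2k+1} − 4^m.) -/

import Mathlib

/-- The Lucas numbers: `L 0 = 2`, `L 1 = 1`, `L (n+2) = L (n+1) + L n`. -/
def lucas : ℕ → ℕ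
  | 0 => 2
  | 1 => 1
  | n + 2 => lucas (n + 1) + lucas n

theorem sumB_succ (k : ℕ) :
    ∑ s ∈ Finset.range (k + 2), Nat.choose (k + 1 + s) (2 * s + 1) =
      ∑ s ∈ Finset.range (k + 1), Nat.choose (k + s) (2 * s) +
        ∑ s ∈ Finset.range (k + 1), Nat.choose (k + s) (2 * s + 1) := by
  rw [Finset.sum_range_succ, Nat.choose_eq_zero_of_lt (by omega), add_zero,
    ← Finset.sum_add_distrib]
  refine Finset.sum_congr rfl fun s _ => ?_
  rw [show k + 1 + s = (k + s) + 1 by ring, Nat.choose_succ_succ']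

theorem sumA_succ (k : ℕ) :
    ∑ s ∈ Finset.range (k + 2), Nat.choose (k + 1 + s) (2 * s) =
      ∑ s ∈ Finset.range (k + 1), Nat.choose (k + s) (2 * s) +
        ∑ s ∈ Finset.range (k + 2), Nat.choose (k + 1 + s) (2 * s + 1) := by
  have h1 : ∑ s ∈ Finset.range (k + 1), Nat.choose (k + s) (2 * s) =
      ∑ s ∈ Finset.range (k + 2), Nat.choose (k + s) (2 * s) := by
    rw [Finset.sum_range_succ _ (k + 1), Nat.choose_eq_zero_of_lt (by omega : k + (k + 1) < _),
      add_zero]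
  rw [h1, Finset.sum_range_succ (fun s => Nat.choose (k + 1 + s) (2 * s + 1)) (k + 1),
    Nat.choose_eq_zero_of_lt (by omega : k + 1 + (k + 1) < _), add_zero,
    Finset.sum_range_succ' _ (k + 1), Finset.sum_range_succ' _ (k + 1)]
  have h2 : ∀ s, Nat.choose (k + 1 + (s + 1)) (2 * (s + 1)) =
      Nat.choose (k + (s + 1)) (2 * (s + 1)) + Nat.choose (k + 1 + s) (2 * s + 1) := by
    intro s
    rw [show k + 1 + (s + 1) = (k + 1 + s) + 1 by ring, show 2 * (s + 1) = (2 * s + 1) + 1 by ring,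
      Nat.choose_succ_succ', show k + (s + 1) = k + 1 + s by ring]
    ring
  simp only [h2, Finset.sum_add_distrib, mul_zero, Nat.choose_zero_right]
  ring

theorem sums_fib (k : ℕ) :
    ∑ s ∈ Finset.range (k + 1), Nat.choose (k + s) (2 * s) = Nat.fib (2 * k + 1) ∧
    ∑ s ∈ Finset.range (k + 1), Nat.choose (k + s) (2 * s + 1) = Nat.fib (2 * k) := by
  induction k with
  | zero => simp
  | succ k ih =>
    have hb := sumB_succ k
    have ha := sumA_succ k
    have f1 : Nat.fib (2 * k + 2) = _ := Nat.fib_add_two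
    have f2 : Nat.fib (2 * k + 1 + 2) = _ := Nat.fib_add_two
    rw [ih.1, ih.2] at hb
    rw [ih.1, hb] at ha
    refine ⟨ha.trans ?_, hb.trans ?_⟩
    · rw [show 2 * (k + 1) + 1 = 2 * k + 1 + 2 by ring, f2, show 2 * k + 1 + 1 = 2 * k + 2 by ring,
        f1]
      ring
    · rw [show 2 * (k + 1) = 2 * k + 2 by ring, f1]
      ring

theorem lucas_fib (n : ℕ) : lucas (n + 1) = Nat.fib (n + 1) + 2 * Nat.fib n ∧
    lucas (n + 2) = Nat.fib (n + 2) + 2 * Nat.fib (n + 1) := by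
  induction n with
  | zero => simp [lucas]
  | succ n ih =>
    refine ⟨ih.2, ?_⟩
    have f1 : Nat.fib (n + 2) = _ := Nat.fib_add_two
    have f2 : Nat.fib (n + 1 + 2) = _ := Nat.fib_add_two
    have l : lucas (n + 1 + 2) = lucas (n + 2) + lucas (n + 1) := rfl
    rw [l, ih.1, ih.2, f2, show n + 1 + 1 = n + 2 by ring, f1]
    ring

theorem term_eq (k s : ℕ) (h : s ≤ k) :
    ((1 + 2 * k : ℚ) / (1 + 2 * s)) * (Nat.choose (k + s) (2 * s)) =
      (Nat.choose (k + s) (2 * s) : ℚ) + 2 * (Nat.choose (k + s) (2 * s + 1)) := by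
  have h0 := Nat.choose_succ_right_eq (k + s) (2 * s)
  rw [show k + s - 2 * s = k - s by omega] at h0
  have h1 : (Nat.choose (k + s) (2 * s + 1) : ℚ) * (2 * s + 1) =
      Nat.choose (k + s) (2 * s) * ((k : ℚ) - s) := by
    rw [← Nat.cast_sub h]
    exact_mod_cast h0
  have hp : (1 + 2 * s : ℚ) ≠ 0 := by positivity
  rw [div_mul_eq_mul_div, div_eq_iff hp]
  linear_combination -2 * h1

theorem lucas_inner_sum (k : ℕ) :
    ∑ s ∈ Finset.range (k + 1), ((1 + 2 * k : ℚ) / (1 + 2 * s)) * (Nat.choose (k + s) (2 * s)) =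
      lucas (2 * k + 1) := by
  rw [Finset.sum_congr rfl fun s hs => term_eq k s (by simp at hs; omega),
    Finset.sum_add_distrib, ← Finset.mul_sum, (lucas_fib (2 * k)).1, ← (sums_fib k).1,
    ← (sums_fib k).2]
  push_cast
  rfl

theorem lucas_pos (n : ℕ) : 0 < lucas n ∧ 0 < lucas (n + 1) := by
  induction n with
  | zero => simp [lucas]
  | succ n ih => exact ⟨ih.2, Nat.add_pos_left ih.2 _⟩

/-- `W_{2m+1}(1) = 0`: for every positive integer `m`,
`∑_{s=0}^{m} ∑_{k=s}^{m} ((1+2k)/(1+2s)) C(2m+1, m-k) C(k+s, 2s) / L_{2k+1} = 4^m`. -/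
theorem W_at_one (m : ℕ) (hm : 0 < m) :
    ∑ s ∈ Finset.range (m + 1), ∑ k ∈ Finset.Icc s m,
        ((1 + 2 * k : ℚ) / (1 + 2 * s)) * (Nat.choose (2 * m + 1) (m - k)) *
          (Nat.choose (k + s) (2 * s)) / (lucas (2 * k + 1)) = 4 ^ m := by
  rw [Finset.sum_comm' (s' := fun k => Finset.range (k + 1)) (t' := Finset.range (m + 1))
    (by intro x y; simp only [Finset.mem_range, Finset.mem_Icc]; omega)]
  have key : ∀ k ∈ Finset.range (m + 1), ∑ s ∈ Finset.range (k + 1),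
      ((1 + 2 * k : ℚ) / (1 + 2 * s)) * (Nat.choose (2 * m + 1) (m - k)) *
          (Nat.choose (k + s) (2 * s)) / (lucas (2 * k + 1)) =
      ((Nat.choose (2 * m + 1) (m + 1 - 1 - k) : ℕ) : ℚ) := by
    intro k _
    have hl : (lucas (2 * k + 1) : ℚ) ≠ 0 := by exact_mod_cast (lucas_pos _).1.ne'
    rw [← Finset.sum_div, div_eq_iff hl, ← lucas_inner_sum k, Finset.mul_sum]
    refine Finset.sum_congr rfl fun s _ => ?_
    rw [Nat.add_sub_cancel]
    ring
  rw [Finset.sum_congr rfl key,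
    Finset.sum_range_reflect (fun j => ((Nat.choose (2 * m + 1) j : ℕ) : ℚ)) (m + 1)]
  exact_mod_cast Nat.sum_range_choose_halfway m
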